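/- Let q ∈ (0,1). Then the entire function x ↦ θ(q,x) has only finitely many non-real zeros; these form an even number 2j (counted with multiplicity), occurring in complex-conjugate pairs, and every real zero of θ(q,·) is negative. Writing the non-real zeros as −η_1, …, −η_{2j} and the real zeros (with multiplicity) as −ξ_1, −ξ_2, … with ξ_k > 0, one has Σ_k 1/ξ_k < ∞ and θ(q,x) = ∏_{i=1}^{2j} (1 + x/η_i) · ∏_k (1 + x/ξ_k) for all x ∈ ℂ; in particular θ(q,·) is the product of a real polynomial of degree 2j with constant term 1 and no real roots, and a function of the Laguerre–Pólya class LP-I. -/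

import Mathlib

/-- The partial theta function `θ(q,x) = ∑_{j≥0} q^{j(j+1)/2} x^j`. -/
noncomputable def theta (q x : ℂ) : ℂ := ∑' j : ℕ, q ^ (j * (j + 1) / 2) * x ^ j

/-- `z` is a zero of `f` of multiplicity exactly `m`. -/
def ZeroMult (f : ℂ → ℂ) (z : ℂ) (m : ℕ) : Prop :=
  (∀ j < m, iteratedDeriv j f z = 0) ∧ iteratedDeriv m f z ≠ 0

theorem exists_eq_one_sub_div_mul {f : ℂ → ℂ} (hf : Differentiable ℂ f) {w : ℂ} (hw : w ≠ 0)
    (h : f w = 0) : ∃ g : ℂ → ℂ, Differentiable ℂ g ∧ ∀ x, f x = (1 - x / w) * g x := by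
  refine ⟨fun x => -w * dslope f w x, ?_, fun x => ?_⟩
  · refine Differentiable.const_mul ?_ _
    rw [← differentiableOn_univ, Complex.differentiableOn_dslope Filter.univ_mem]
    exact hf.differentiableOn
  · have := sub_smul_dslope f w x
    rw [h, sub_zero, smul_eq_mul] at this
    rw [← this]
    field_simp
    ring

theorem analyticOrderAt_one_sub_div {w : ℂ} (hw : w ≠ 0) (u : ℂ) [Decidable (w = u)] :
    analyticOrderAt (fun x : ℂ => 1 - x / w) u = if w = u then 1 else 0 := by
  have hd : ∀ u : ℂ, AnalyticAt ℂ (fun x : ℂ => 1 - x / w) u := fun u => by fun_prop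
  split_ifs with h
  · subst h
    refine (hd w).analyticOrderAt_eq_one_of_zero_deriv_ne_zero (by simp [hw]) ?_
    simp [hw]
  · rw [(hd u).analyticOrderAt_eq_zero]
    intro h0
    apply h
    exact ((div_eq_one_iff_eq hw).mp (sub_eq_zero.mp h0).symm).symm

/-- Dividing an entire function by the factors `1 - x / z i`, where no zero is used more often than
its multiplicity. -/
theorem exists_eq_prod_one_sub_div_mul {ι : Type*} {f : ℂ → ℂ} (hf : Differentiable ℂ f)
    (z : ι → ℂ) (s : Finset ι) (hz : ∀ i ∈ s, z i ≠ 0)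
    (hs : ∀ u, ({i | i ∈ s ∧ z i = u} : Set ι).encard ≤ analyticOrderAt f u) :
    ∃ g : ℂ → ℂ, Differentiable ℂ g ∧ (∀ x, f x = (∏ i ∈ s, (1 - x / z i)) * g x) ∧
      ∀ u, analyticOrderAt f u =
        ({i | i ∈ s ∧ z i = u} : Set ι).encard + analyticOrderAt g u := by
  classical
  induction s using Finset.induction_on with
  | empty => exact ⟨f, hf, by simp, by simp⟩
  | insert a s ha ih =>
    have hcard : ∀ u, ({i | i ∈ insert a s ∧ z i = u} : Set ι).encard =
        ({i | i ∈ s ∧ z i = u} : Set ι).encard + if z a = u then 1 else 0 := by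
      intro u
      split_ifs with h
      · rw [← Set.encard_insert_of_notMem (a := a) (by simp [ha])]
        congr 1
        ext i
        simp only [Finset.mem_insert, Set.mem_ofPred_eq, Set.mem_insert_iff]
        grind
      · rw [add_zero]
        congr 1
        ext i
        simp only [Finset.mem_insert, Set.mem_ofPred_eq]
        grind
    obtain ⟨g, hg, hfg, hog⟩ := ih (fun i hi => hz i (Finset.mem_insert_of_mem hi))
      (fun u => le_trans (by rw [hcard]; exact le_self_add) (hs u))
    have hza := hz a (Finset.mem_insert_self _ _)
    have hfin : ({i | i ∈ s ∧ z i = z a} : Set ι).encard ≠ ⊤ :=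
      Set.encard_ne_top_iff.mpr (s.finite_toSet.subset fun i hi => hi.1)
    have hga : g (z a) = 0 := by
      have h1 := hs (z a)
      rw [hcard, hog, if_pos rfl, ENat.add_le_add_iff_left hfin] at h1
      exact apply_eq_zero_of_analyticOrderAt_ne_zero (fun h => by simp [h] at h1)
    obtain ⟨k, hk, hgk⟩ := exists_eq_one_sub_div_mul hg hza hga
    refine ⟨k, hk, fun x => ?_, fun u => ?_⟩
    · rw [hfg, hgk, Finset.prod_insert ha]; ring
    · rw [hog, hcard, add_assoc, show g = (fun x => 1 - x / z a) * k from funext hgk,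
        analyticOrderAt_mul (by fun_prop) (hk.analyticAt u), analyticOrderAt_one_sub_div hza]

/-- A zero-free function on a disc that is normalised at the centre and bounded by `exp M`
has a logarithm that is `O(M)`, with an explicit constant. -/
theorem exists_exp_eq_and_norm_le {g : ℂ → ℂ} {R M : ℝ} (hR : 0 < R) (hM : 0 < M)
    (hg : DifferentiableOn ℂ g (Metric.ball 0 R)) (h0 : g 0 = 1)
    (hne : ∀ x ∈ Metric.ball (0 : ℂ) R, g x ≠ 0)
    (hb : ∀ x ∈ Metric.ball (0 : ℂ) R, ‖g x‖ ≤ Real.exp M) {x : ℂ}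
    (hx : x ∈ Metric.ball (0 : ℂ) R) :
    ∃ h : ℂ, g x = Complex.exp h ∧ ‖h‖ ≤ 2 * M * ‖x‖ / (R - ‖x‖) := by
  have hd : DifferentiableOn ℂ (fun y => deriv g y / g y) (Metric.ball 0 R) :=
    (hg.deriv Metric.isOpen_ball).div hg hne
  obtain ⟨F, hF⟩ := hd.isExactOn_ball
  have h00 : (0 : ℂ) ∈ Metric.ball (0 : ℂ) R := Metric.mem_ball_self hR
  have hconst : ∀ y ∈ Metric.ball (0 : ℂ) R,
      g y * Complex.exp (-(F y - F 0)) = g 0 * Complex.exp (-(F 0 - F 0)) := by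
    intro y hy
    have hder : ∀ y ∈ Metric.ball (0 : ℂ) R,
        HasDerivAt (fun y => g y * Complex.exp (-(F y - F 0))) 0 y := by
      intro y hy
      have h1 := (hg.differentiableAt (Metric.isOpen_ball.mem_nhds hy)).hasDerivAt
      have h2 := ((hF y hy).sub_const (F 0)).neg.cexp
      convert! h1.mul h2 using 1
      have := hne y hy
      field_simp
      ring
    refine (convex_ball (0 : ℂ) R).is_const_of_fderivWithin_eq_zero (𝕜 := ℂ)
      (fun y hy => (hder y hy).differentiableAt.differentiableWithinAt) (fun y hy => ?_) hy h00
    rw [fderivWithin_of_isOpen Metric.isOpen_ball hy]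
    ext
    simpa using (hder y hy).deriv
  have hexp : ∀ y ∈ Metric.ball (0 : ℂ) R, g y = Complex.exp (F y - F 0) := by
    intro y hy
    have := hconst y hy
    rw [h0, sub_self, neg_zero, Complex.exp_zero, mul_one, Complex.exp_neg] at this
    exact (mul_inv_eq_one₀ (Complex.exp_ne_zero _)).mp this
  refine ⟨F x - F 0, hexp x hx, ?_⟩
  refine Complex.borelCaratheodory_zero (f := fun y => F y - F 0) hM
    (fun y hy => ((hF y hy).differentiableAt.sub_const _).differentiableWithinAt) ?_ hR hx
    (sub_self _)
  intro y hy
  have := hb y hy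
  rw [hexp y hy, Complex.norm_exp, Real.exp_le_exp] at this
  exact this

theorem Finset.prod_range_pow_sub (s : ℝ) (n L : ℕ) :
    ∏ i ∈ Finset.range n, s ^ (2 * (n + L - i)) = s ^ (2 * n * L + n * (n + 1)) := by
  rw [Finset.prod_pow_eq_pow_sum]
  congr 1
  induction n with
  | zero => simp
  | succ n ih =>
    rw [Finset.sum_range_succ']
    have : ∀ i, n + 1 + L - (i + 1) = n + L - i := fun i => by omega
    simp only [this, ih]
    rw [Nat.sub_zero]
    ring

/-- An entire function with `f 0 = 1` that grows like `s ^ (n ^ 2)` on the circles of radius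
`c * s ^ (2 * n)`, whose zeros `z`, listed with multiplicity, contain a sequence with
`c * s ^ (2 * i) / s ^ 2 ≤ ‖z (d i)‖ ≤ c * s ^ (2 * i)`. -/
structure ThetaGrowth {W : Type*} (f : ℂ → ℂ) (z : W → ℂ) (d : ℕ → W) (c s B C : ℝ) : Prop where
  diff : Differentiable ℂ f
  map_zero : f 0 = 1
  encard_eq : ∀ u, ({w | z w = u} : Set W).encard = analyticOrderAt f u
  inj : Function.Injective d
  c_pos : 0 < c
  one_lt_s : 1 < s
  one_le_B : 1 ≤ B
  one_le_C : 1 ≤ C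
  le_norm : ∀ i, c * s ^ (2 * i) ≤ s ^ 2 * ‖z (d i)‖
  norm_le : ∀ i, ‖z (d i)‖ ≤ c * s ^ (2 * i)
  bound : ∀ n : ℕ, ∀ x : ℂ, ‖x‖ = c * s ^ (2 * n) → ‖f x‖ ≤ C * B ^ n * s ^ (n ^ 2)

namespace ThetaGrowth

variable {W : Type*} {f : ℂ → ℂ} {z : W → ℂ} {d : ℕ → W} {c s B C : ℝ}

theorem apply_eq_zero (h : ThetaGrowth f z d c s B C) (w : W) : f (z w) = 0 := by
  apply apply_eq_zero_of_analyticOrderAt_ne_zero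
  rw [← h.encard_eq, Set.encard_ne_zero]
  exact ⟨w, rfl⟩

theorem ne_zero (h : ThetaGrowth f z d c s B C) (w : W) : z w ≠ 0 := by
  intro h0
  have := h.apply_eq_zero w
  rw [h0, h.map_zero] at this
  exact one_ne_zero this

theorem exists_quotient (h : ThetaGrowth f z d c s B C) (S : Finset W) :
    ∃ g : ℂ → ℂ, Differentiable ℂ g ∧ (∀ x, f x = (∏ i ∈ S, (1 - x / z i)) * g x) ∧ g 0 = 1 ∧
      ∀ u, (∀ w, z w = u → w ∈ S) → g u ≠ 0 := by
  obtain ⟨g, hg, hfg, hog⟩ := exists_eq_prod_one_sub_div_mul h.diff z S (fun i _ => h.ne_zero i)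
    (fun u => by rw [← h.encard_eq]; exact Set.encard_le_encard fun i hi => hi.2)
  refine ⟨g, hg, hfg, ?_, fun u hu => ?_⟩
  · have := hfg 0
    simpa [h.map_zero] using this.symm
  · have h1 := hog u
    have h2 : ({i | i ∈ S ∧ z i = u} : Set W) = {w | z w = u} := by
      ext w
      simp only [Set.mem_ofPred_eq]
      exact ⟨fun h => h.2, fun h => ⟨hu w h, h⟩⟩
    have hfin : ({w | z w = u} : Set W).encard ≠ ⊤ := by
      rw [← h2]
      exact Set.encard_ne_top_iff.mpr (S.finite_toSet.subset fun i hi => hi.1)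
    rw [← h.encard_eq, h2] at h1
    have h3 : analyticOrderAt g u = 0 := by
      have : ({w | z w = u} : Set W).encard + analyticOrderAt g u ≤
        ({w | z w = u} : Set W).encard + 0 := by rw [← h1, add_zero]
      exact nonpos_iff_eq_zero.mp ((ENat.add_le_add_iff_left hfin).mp this)
    exact ((hg.analyticAt u).analyticOrderAt_eq_zero).mp h3

theorem exists_two_le (h : ThetaGrowth f z d c s B C) : ∃ L : ℕ, 2 ≤ s ^ (2 * L) := by
  obtain ⟨L, hL⟩ := pow_unbounded_of_one_lt 2 h.one_lt_s
  exact ⟨L, hL.le.trans (pow_le_pow_right₀ h.one_lt_s.le (by omega))⟩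

/-- The half-power lower bound for a factor belonging to a zero well inside the circle. -/
theorem half_le (h : ThetaGrowth f z d c s B C) {L : ℕ} (hL : 2 ≤ s ^ (2 * L)) {w : W} {m n : ℕ}
    (hmn : m ≤ n) (hw : ‖z w‖ ≤ c * s ^ (2 * m)) :
    s ^ (2 * (n + L - m)) / 2 ≤ c * s ^ (2 * (n + L)) / ‖z w‖ - 1 := by
  have hs := h.one_lt_s
  have hz : 0 < ‖z w‖ := norm_pos_iff.mpr (h.ne_zero w)
  have h1 : s ^ (2 * (n + L - m)) ≤ c * s ^ (2 * (n + L)) / ‖z w‖ := by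
    rw [le_div_iff₀ hz]
    calc s ^ (2 * (n + L - m)) * ‖z w‖ ≤ s ^ (2 * (n + L - m)) * (c * s ^ (2 * m)) := by gcongr
      _ = c * s ^ (2 * (n + L)) := by
        rw [mul_left_comm, ← pow_add]; congr 2; omega
  have h2 : 2 ≤ s ^ (2 * (n + L - m)) :=
    hL.trans (pow_le_pow_right₀ hs.le (by omega))
  linarith

theorem norm_quotient_mul_le [DecidableEq W] (h : ThetaGrowth f z d c s B C) {L : ℕ}
    (hL : 2 ≤ s ^ (2 * L))
    {n : ℕ} {S : Finset W} (hS : ∀ w ∈ S, ‖z w‖ ≤ c * s ^ (2 * n)) (hd : ∀ i < n, d i ∈ S)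
    {g : ℂ → ℂ} (hg : Differentiable ℂ g) (hfg : ∀ x, f x = (∏ i ∈ S, (1 - x / z i)) * g x)
    {x : ℂ} (hx : ‖x‖ ≤ c * s ^ (2 * (n + L))) :
    ‖g x‖ * ∏ w ∈ S \ (Finset.range n).image d, (c * s ^ (2 * (n + L)) / ‖z w‖ - 1) ≤
      C * B ^ L * s ^ (L ^ 2) * (2 * B) ^ n := by
  have hs := h.one_lt_s
  have hs0 : 0 < s := by linarith
  have hB := h.one_le_B
  have hC := h.one_le_C
  set R : ℝ := c * s ^ (2 * (n + L)) with hR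
  have hRpos : 0 < R := mul_pos h.c_pos (by positivity)
  set D : Finset W := (Finset.range n).image d with hD
  have hfac : ∀ w ∈ S, 1 ≤ R / ‖z w‖ - 1 := fun w hw => by
    have h1 := h.half_le hL le_rfl (hS w hw)
    have h2 : s ^ (2 * (n + L - n)) = s ^ (2 * L) := by congr 2; omega
    rw [h2] at h1
    linarith
  set P := ∏ w ∈ S \ D, (R / ‖z w‖ - 1) with hP
  have hPpos : 0 < P := Finset.prod_pos fun w hw => by
    have := hfac w (Finset.mem_sdiff.mp hw).1; linarith
  have hDS : D ⊆ S := by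
    intro w hw
    obtain ⟨i, hi, rfl⟩ := Finset.mem_image.mp hw
    exact hd i (Finset.mem_range.mp hi)
  have hDprod : s ^ (2 * n * L + n * (n + 1)) / 2 ^ n ≤ ∏ w ∈ D, (R / ‖z w‖ - 1) := by
    rw [hD, Finset.prod_image (fun a _ b _ hab => h.inj hab), ← Finset.prod_range_pow_sub]
    have : (2 : ℝ) ^ n = ∏ i ∈ Finset.range n, 2 := by simp
    rw [this, ← Finset.prod_div_distrib]
    refine Finset.prod_le_prod (fun i _ => by positivity) fun i hi => ?_
    exact h.half_le hL (Finset.mem_range.mp hi).le (h.norm_le i)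
  have hcircle : ∀ y ∈ frontier (Metric.ball (0 : ℂ) R),
      ‖g y‖ ≤ C * B ^ L * s ^ (L ^ 2) * (2 * B) ^ n / P := by
    intro y hy
    rw [frontier_ball _ hRpos.ne', mem_sphere_zero_iff_norm] at hy
    rw [le_div_iff₀ hPpos]
    have h1 := h.bound (n + L) y hy
    rw [hfg, norm_mul, norm_prod, ← Finset.prod_sdiff hDS] at h1
    have h2 : ∀ w ∈ S, R / ‖z w‖ - 1 ≤ ‖1 - y / z w‖ := fun w _ => by
      have := norm_sub_norm_le (y / z w) 1
      rwa [norm_div, hy, norm_one, norm_sub_rev] at this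
    have h3 : P ≤ ∏ w ∈ S \ D, ‖1 - y / z w‖ :=
      Finset.prod_le_prod (fun w hw => by
        have := hfac w (Finset.mem_sdiff.mp hw).1; linarith)
        fun w hw => h2 w (Finset.mem_sdiff.mp hw).1
    have h4 : s ^ (2 * n * L + n * (n + 1)) / 2 ^ n ≤ ∏ w ∈ D, ‖1 - y / z w‖ :=
      hDprod.trans (Finset.prod_le_prod (fun w hw => by have := hfac w (hDS hw); linarith)
        fun w hw => h2 w (hDS hw))
    have h5 : P * (s ^ (2 * n * L + n * (n + 1)) / 2 ^ n) * ‖g y‖ ≤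
        C * B ^ (n + L) * s ^ ((n + L) ^ 2) := by
      refine le_trans ?_ h1
      gcongr
    have h6 : C * B ^ (n + L) * s ^ ((n + L) ^ 2) ≤
        (C * B ^ L * s ^ (L ^ 2) * (2 * B) ^ n) * (s ^ (2 * n * L + n * (n + 1)) / 2 ^ n) := by
      have h7 : s ^ ((n + L) ^ 2) ≤ s ^ (L ^ 2) * s ^ (2 * n * L + n * (n + 1)) := by
        rw [← pow_add]
        exact pow_le_pow_right₀ hs.le (by nlinarith)
      calc C * B ^ (n + L) * s ^ ((n + L) ^ 2)
          ≤ C * B ^ (n + L) * (s ^ (L ^ 2) * s ^ (2 * n * L + n * (n + 1))) := by gcongr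
        _ = _ := by rw [mul_pow, pow_add B]; field_simp
    have h8 : 0 < s ^ (2 * n * L + n * (n + 1)) / 2 ^ n := by positivity
    refine le_of_mul_le_mul_right ?_ h8
    calc ‖g y‖ * P * (s ^ (2 * n * L + n * (n + 1)) / 2 ^ n) =
        P * (s ^ (2 * n * L + n * (n + 1)) / 2 ^ n) * ‖g y‖ := by ring
      _ ≤ _ := h5.trans h6
  rw [← le_div_iff₀ hPpos]
  refine Complex.norm_le_of_forall_mem_frontier_norm_le Metric.isBounded_ball
    hg.diffContOnCl hcircle ?_
  rw [closure_ball _ hRpos.ne']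
  simpa using hx

/-- All but finitely many zeros, counted with multiplicity, belong to the sequence `d`. -/
theorem finite_compl_range (h : ThetaGrowth f z d c s B C) : (Set.range d)ᶜ.Finite := by
  classical
  by_contra hinf
  have hs := h.one_lt_s
  have hs0 : 0 < s := by linarith
  have hB := h.one_le_B
  have hC := h.one_le_C
  obtain ⟨L, hL⟩ := h.exists_two_le
  obtain ⟨M, hM⟩ := pow_unbounded_of_one_lt (2 * B) (one_lt_pow₀ hs two_ne_zero)
  obtain ⟨E, hE, hEM⟩ := Set.Infinite.exists_subset_card_eq hinf M
  obtain ⟨m, hm⟩ : ∃ m : ℕ, ∀ w ∈ E, ‖z w‖ ≤ c * s ^ (2 * m) := by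
    obtain ⟨m, hm⟩ := pow_unbounded_of_one_lt ((∑ w ∈ E, ‖z w‖) / c) hs
    refine ⟨m, fun w hw => ?_⟩
    have h1 : ‖z w‖ ≤ ∑ w ∈ E, ‖z w‖ :=
      Finset.single_le_sum (f := fun w => ‖z w‖) (fun _ _ => norm_nonneg _) hw
    have h2 := (div_lt_iff₀ h.c_pos).mp hm
    have h3 : s ^ m ≤ s ^ (2 * m) := pow_le_pow_right₀ hs.le (by omega)
    have := h.c_pos
    nlinarith
  set K : ℝ := C * B ^ L * s ^ (L ^ 2) with hK
  have key : ∀ n, m ≤ n → ((s ^ (2 * L) / (2 * s ^ (2 * m))) ^ M) * ((s ^ 2) ^ M) ^ n ≤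
      K * (2 * B) ^ n := by
    intro n hn
    have hD : ∀ w ∈ (Finset.range n).image d, ∃ i < n, d i = w := fun w hw => by
      obtain ⟨i, hi, rfl⟩ := Finset.mem_image.mp hw
      exact ⟨i, Finset.mem_range.mp hi, rfl⟩
    have hSE : (E ∪ (Finset.range n).image d) \ (Finset.range n).image d = E := by
      rw [Finset.union_sdiff_right, Finset.sdiff_eq_self_iff_disjoint, Finset.disjoint_left]
      intro w hw hw'
      obtain ⟨i, _, rfl⟩ := hD w hw'
      exact hE hw ⟨i, rfl⟩
    obtain ⟨g, hg, hfg, hg0, -⟩ := h.exists_quotient (E ∪ (Finset.range n).image d)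
    have h1 := h.norm_quotient_mul_le hL (n := n) (x := 0) (fun w hw => by
      rcases Finset.mem_union.mp hw with hw | hw
      · refine (hm w hw).trans ?_
        have := h.c_pos
        have := pow_le_pow_right₀ hs.le (show 2 * m ≤ 2 * n by omega)
        gcongr
      · obtain ⟨i, hi, rfl⟩ := hD w hw
        refine (h.norm_le i).trans ?_
        have := h.c_pos
        have := pow_le_pow_right₀ hs.le (show 2 * i ≤ 2 * n by omega)
        gcongr) (fun i hi => Finset.mem_union_right _
          (Finset.mem_image_of_mem _ (Finset.mem_range.mpr hi))) hg hfg
      (by rw [norm_zero]; have := h.c_pos; positivity)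
    rw [hSE, hg0, norm_one, one_mul] at h1
    refine le_trans ?_ h1
    calc ((s ^ (2 * L) / (2 * s ^ (2 * m))) ^ M) * ((s ^ 2) ^ M) ^ n
        = ∏ w ∈ E, s ^ (2 * (n + L - m)) / 2 := by
          rw [Finset.prod_const, hEM, pow_right_comm, ← mul_pow]
          congr 1
          rw [div_mul_eq_mul_div, div_eq_div_iff (by positivity) (by positivity), ← pow_mul,
            ← pow_add, mul_left_comm, ← pow_add, mul_comm]
          congr 2
          omega
      _ ≤ _ := Finset.prod_le_prod (fun _ _ => by positivity) fun w hw =>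
          h.half_le hL hn (hm w hw)
  have htend : Filter.Tendsto (fun n : ℕ => ((s ^ 2) ^ M / (2 * B)) ^ n) Filter.atTop
      Filter.atTop := tendsto_pow_atTop_atTop_of_one_lt (by
        rw [one_lt_div (by positivity)]; exact hM)
  obtain ⟨n, hn1, hn2⟩ := ((htend.eventually_gt_atTop
    (K / (s ^ (2 * L) / (2 * s ^ (2 * m))) ^ M)).and (Filter.eventually_ge_atTop m)).exists
  have := key n hn2
  have hpos : 0 < (s ^ (2 * L) / (2 * s ^ (2 * m))) ^ M := by positivity
  rw [div_pow ((s ^ 2) ^ M), div_lt_div_iff₀ hpos (by positivity)] at hn1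
  linarith

theorem summable_inv_norm (h : ThetaGrowth f z d c s B C) : Summable fun w => ‖z w‖⁻¹ := by
  have hs := h.one_lt_s
  have hs0 : 0 < s := by linarith
  have hc := h.c_pos
  rw [← h.finite_compl_range.summable_compl_iff, compl_compl,
    ← (Equiv.ofInjective d h.inj).summable_iff]
  have hgeo : Summable fun i : ℕ => s ^ 2 / c * ((s ^ 2)⁻¹) ^ i :=
    (summable_geometric_of_lt_one (by positivity)
      (inv_lt_one_of_one_lt₀ (one_lt_pow₀ hs two_ne_zero))).mul_left _
  refine hgeo.of_nonneg_of_le (fun i => by simp) fun i => ?_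
  have hz : 0 < ‖z (d i)‖ := norm_pos_iff.mpr (h.ne_zero _)
  have := h.le_norm i
  simp only [Function.comp_apply, Equiv.ofInjective_apply]
  rw [inv_pow, ← pow_mul, ← div_eq_mul_inv, div_div, inv_eq_one_div,
    div_le_div_iff₀ hz (by positivity)]
  linarith

theorem tendsto_affine_div_pow_sub {s c : ℝ} (hs : 1 < s) (hc : 0 < c) (a b r : ℝ) :
    Filter.Tendsto (fun n : ℕ => 2 * (a + n * b) * r / (c * s ^ (2 * n) - r)) Filter.atTop
      (nhds 0) := by
  have hs2 : 1 < s ^ 2 := one_lt_pow₀ hs two_ne_zero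
  have h0 : Filter.Tendsto (fun n : ℕ => ((s ^ 2) ^ n)⁻¹) Filter.atTop (nhds 0) :=
    (tendsto_pow_atTop_atTop_of_one_lt hs2).inv_tendsto_atTop
  have h1 : Filter.Tendsto (fun n : ℕ => (n : ℝ) / (s ^ 2) ^ n) Filter.atTop (nhds 0) := by
    simpa using tendsto_pow_const_div_const_pow_of_one_lt 1 hs2
  have hnum : Filter.Tendsto (fun n : ℕ =>
      2 * (a * ((s ^ 2) ^ n)⁻¹ + (n : ℝ) / (s ^ 2) ^ n * b) * r) Filter.atTop
      (nhds (2 * (a * 0 + 0 * b) * r)) :=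
    (((h0.const_mul a).add (h1.mul_const b)).const_mul 2).mul_const r
  have hden : Filter.Tendsto (fun n : ℕ => c - r * ((s ^ 2) ^ n)⁻¹) Filter.atTop
      (nhds (c - r * 0)) := (h0.const_mul r).const_sub c
  have := hnum.div hden (by simpa using hc.ne')
  rw [show 2 * (a * 0 + 0 * b) * r / (c - r * 0) = 0 by simp] at this
  refine this.congr fun n => ?_
  have hp : (s ^ 2) ^ n ≠ 0 := by positivity
  simp only [Pi.div_apply]
  rw [← mul_div_mul_right _ (c - r * ((s ^ 2) ^ n)⁻¹) hp]
  congr 1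
  · field_simp
  · rw [pow_mul]; field_simp

/-- The Hadamard factorisation of `f`. -/
theorem hasProd (h : ThetaGrowth f z d c s B C) (x : ℂ) :
    HasProd (fun w => 1 - x / z w) (f x) := by
  classical
  have hs := h.one_lt_s
  have hs0 : 0 < s := by linarith
  have hc := h.c_pos
  have hB := h.one_le_B
  have hC := h.one_le_C
  obtain ⟨L, hL⟩ := h.exists_two_le
  have hmul : Multipliable fun w => 1 - x / z w := by
    have : Summable fun w => -(x / z w) := by
      refine Summable.of_norm ?_
      simpa [div_eq_mul_inv] using h.summable_inv_norm.mul_left ‖x‖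
    simpa [sub_eq_add_neg] using Complex.multipliable_one_add_of_summable this
  have hfin : ∀ n : ℕ, {w | ‖z w‖ ≤ c * s ^ (2 * n)}.Finite := by
    intro n
    have hp : 0 < c * s ^ (2 * n) := by positivity
    have := h.summable_inv_norm.tendsto_cofinite_zero.eventually_lt_const (inv_pos.mpr hp)
    refine this.subset fun w hw => ?_
    have hz : 0 < ‖z w‖ := norm_pos_iff.mpr (h.ne_zero w)
    simp only [Set.mem_compl_iff, Set.mem_ofPred_eq, not_lt] at hw ⊢
    exact inv_anti₀ hz hw
  set S : ℕ → Finset W := fun n => (hfin n).toFinset with hSdef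
  have hSmem : ∀ n w, w ∈ S n ↔ ‖z w‖ ≤ c * s ^ (2 * n) := fun n w => by simp [hSdef]
  have hmono : ∀ {m n : ℕ}, m ≤ n → c * s ^ (2 * m) ≤ c * s ^ (2 * n) := fun {m n} hmn => by
    have := pow_le_pow_right₀ hs.le (show 2 * m ≤ 2 * n by omega)
    gcongr
  have hStend : Filter.Tendsto S Filter.atTop Filter.atTop := by
    refine Filter.tendsto_atTop_finset_of_monotone (fun m n hmn w hw => ?_) fun w => ?_
    · rw [hSmem] at hw ⊢
      exact hw.trans (hmono hmn)
    · obtain ⟨n, hn⟩ := pow_unbounded_of_one_lt (‖z w‖ / c) hs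
      refine ⟨n, (hSmem n w).mpr ?_⟩
      have h2 := (div_lt_iff₀ hc).mp hn
      have h3 : s ^ n ≤ s ^ (2 * n) := pow_le_pow_right₀ hs.le (by omega)
      nlinarith
  choose g hg hfg hg0 hgne using fun n => h.exists_quotient (S n)
  set K : ℝ := C * B ^ L * s ^ (L ^ 2) with hK
  have hK1 : 1 ≤ K := by
    have h1 := one_le_pow₀ hB (n := L)
    have h2 := one_le_pow₀ hs.le (n := L ^ 2)
    nlinarith [mul_le_mul hC h1 zero_le_one (by linarith)]
  have hbound : ∀ n, ∀ y ∈ Metric.ball (0 : ℂ) (c * s ^ (2 * n)),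
      ‖g n y‖ ≤ Real.exp (Real.log K + 1 + n * Real.log (2 * B)) := by
    intro n y hy
    have hy' : ‖y‖ ≤ c * s ^ (2 * (n + L)) :=
      (mem_ball_zero_iff.mp hy).le.trans (hmono (by omega))
    have h1 := h.norm_quotient_mul_le hL (fun w hw => (hSmem n w).mp hw)
      (fun i hi => (hSmem n _).mpr ((h.norm_le i).trans (hmono hi.le))) (hg n) (hfg n) hy'
    have h2 : 1 ≤ ∏ w ∈ S n \ (Finset.range n).image d,
        (c * s ^ (2 * (n + L)) / ‖z w‖ - 1) := by
      refine Finset.one_le_prod fun w hw => ?_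
      have h3 := h.half_le hL le_rfl ((hSmem n w).mp (Finset.mem_sdiff.mp hw).1)
      have h4 : s ^ (2 * (n + L - n)) = s ^ (2 * L) := by congr 2; omega
      rw [h4] at h3
      linarith
    calc ‖g n y‖ ≤ K * (2 * B) ^ n := le_trans (le_mul_of_one_le_right (norm_nonneg _) h2) h1
      _ = Real.exp (Real.log K + n * Real.log (2 * B)) := by
        rw [Real.exp_add, Real.exp_log (by linarith), mul_comm (n : ℝ), ← Real.rpow_def_of_pos
          (by linarith), Real.rpow_natCast]
      _ ≤ _ := Real.exp_le_exp.mpr (by linarith)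
  have hone : Filter.Tendsto (fun n => g n x) Filter.atTop (nhds 1) := by
    have hlarge : ∀ᶠ n : ℕ in Filter.atTop, ‖x‖ < c * s ^ (2 * n) := by
      have := (tendsto_pow_atTop_atTop_of_one_lt (one_lt_pow₀ hs two_ne_zero)).eventually_gt_atTop
        (‖x‖ / c)
      filter_upwards [this] with n hn
      rw [div_lt_iff₀ hc, ← pow_mul] at hn
      linarith
    have hlog : ∀ n : ℕ, ∃ t : ℂ, ‖x‖ < c * s ^ (2 * n) → g n x = Complex.exp t ∧
        ‖t‖ ≤ 2 * (Real.log K + 1 + n * Real.log (2 * B)) * ‖x‖ / (c * s ^ (2 * n) - ‖x‖) := by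
      intro n
      by_cases hx : ‖x‖ < c * s ^ (2 * n)
      · have hM : 0 < Real.log K + 1 + n * Real.log (2 * B) := by
          have := Real.log_nonneg hK1
          have := Real.log_nonneg (show 1 ≤ 2 * B by linarith)
          positivity
        obtain ⟨t, ht⟩ := exists_exp_eq_and_norm_le (g := g n) (R := c * s ^ (2 * n))
          (by positivity) hM (hg n).differentiableOn (hg0 n)
          (fun y hy => hgne n y fun w hw => (hSmem n w).mpr
            (by rw [hw]; exact (mem_ball_zero_iff.mp hy).le)) (hbound n)
          (mem_ball_zero_iff.mpr hx)
        exact ⟨t, fun _ => ht⟩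
      · exact ⟨0, fun h => absurd h hx⟩
    choose t ht using hlog
    have htend : Filter.Tendsto t Filter.atTop (nhds 0) := by
      refine squeeze_zero_norm' ?_ (tendsto_affine_div_pow_sub hs hc (Real.log K + 1)
        (Real.log (2 * B)) ‖x‖)
      filter_upwards [hlarge] with n hn using (ht n hn).2
    have := (Complex.continuous_exp.tendsto 0).comp htend
    rw [Complex.exp_zero] at this
    refine this.congr' ?_
    filter_upwards [hlarge] with n hn using (ht n hn).1.symm
  have hlim := (hmul.hasProd.comp hStend).mul hone
  have hconst : Filter.Tendsto (fun _ : ℕ => f x) Filter.atTop (nhds (f x)) := tendsto_const_nhds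
  have heq := tendsto_nhds_unique hconst (hlim.congr fun n => (hfg n x).symm)
  rw [mul_one] at heq
  rw [heq]
  exact hmul.hasProd

end ThetaGrowth

/-- The real Gaussian sequence `exp (-π m² t)`, with alternating signs. -/
theorem exists_hasSum_neg_one_zpow_mul_exp {t : ℝ} (ht : 0 < t) :
    ∃ v : ℝ, 0 < v ∧
      HasSum (fun m : ℤ => (-1 : ℝ) ^ m * Real.exp (-Real.pi * (m : ℝ) ^ 2 * t)) v := by
  refine ⟨HurwitzZeta.cosKernel ((1 / 2 : ℝ) : UnitAddCircle) t, ?_, ?_⟩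
  · have h1 := HurwitzZeta.evenKernel_functional_equation ((1 / 2 : ℝ) : UnitAddCircle) (1 / t)
    have h2 : 0 < HurwitzZeta.evenKernel ((1 / 2 : ℝ) : UnitAddCircle) (1 / t) := by
      have h3 := HurwitzZeta.hasSum_int_evenKernel (1 / 2) (one_div_pos.mpr ht)
      rw [← h3.tsum_eq]
      exact h3.summable.tsum_pos (fun n => (Real.exp_pos _).le) 0 (Real.exp_pos _)
    rw [h1, one_div_one_div] at h2
    exact (pos_iff_pos_of_mul_pos h2).mp (by positivity)
  · have h := HurwitzZeta.hasSum_int_cosKernel (1 / 2) ht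
    rw [← Complex.hasSum_ofReal]
    refine h.congr_fun fun m => ?_
    have : Complex.exp (2 * Real.pi * Complex.I * ((1 / 2 : ℝ) : ℂ) * m) = (-1) ^ m := by
      rw [← Complex.exp_pi_mul_I, ← Complex.exp_int_mul]
      congr 1
      push_cast
      ring
    rw [this]
    push_cast
    ring

theorem summable_exp_neg_pi_sq {t : ℝ} (ht : 0 < t) :
    Summable fun m : ℤ => Real.exp (-Real.pi * (m : ℝ) ^ 2 * t) := by
  simpa using (HurwitzZeta.hasSum_int_evenKernel 0 ht).summable

theorem exp_pow_triangular (t : ℝ) (j : ℕ) :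
    Real.exp (-2 * Real.pi * t) ^ (j * (j + 1) / 2) = Real.exp (-Real.pi * t * (j * (j + 1))) := by
  have h : ((j * (j + 1) / 2 : ℕ) : ℝ) = (j * (j + 1) : ℝ) / 2 := by
    rw [Nat.cast_div (even_iff_two_dvd.mp (Nat.even_mul_succ_self j)) two_ne_zero]
    push_cast
    ring
  rw [← Real.exp_nat_mul, h]
  congr 1
  ring

theorem exp_pow_triangular_mul (t : ℝ) (k j : ℕ) :
    Real.exp (-2 * Real.pi * t) ^ (j * (j + 1) / 2) *
      Real.exp (Real.pi * t * (2 * k + 1)) ^ j =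
    Real.exp (Real.pi * t * k ^ 2) * Real.exp (-Real.pi * (((j : ℤ) - k : ℤ) : ℝ) ^ 2 * t) := by
  rw [exp_pow_triangular, ← Real.exp_nat_mul, ← Real.exp_add, ← Real.exp_add]
  congr 1
  push_cast
  ring

section theta

variable {q : ℝ}

theorem summable_theta_real (h0 : 0 < q) (h1 : q < 1) (r : ℝ) :
    Summable fun j : ℕ => q ^ (j * (j + 1) / 2) * r ^ j := by
  have htend : Filter.Tendsto (fun j : ℕ => q ^ (j / 2) * |r|) Filter.atTop (nhds 0) := by
    rw [← zero_mul |r|]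
    exact ((tendsto_pow_atTop_nhds_zero_of_lt_one h0.le h1).comp
      (Nat.tendsto_div_const_atTop two_ne_zero)).mul_const _
  refine Summable.of_norm_bounded_eventually_nat (summable_geometric_two) ?_
  filter_upwards [htend.eventually_le_const (show (0 : ℝ) < 1 / 2 by norm_num)] with j hj
  rw [norm_mul, norm_pow, norm_pow, Real.norm_eq_abs, Real.norm_eq_abs, abs_of_pos h0]
  calc q ^ (j * (j + 1) / 2) * |r| ^ j ≤ q ^ (j / 2 * j) * |r| ^ j := by
        gcongr 1
        refine pow_le_pow_of_le_one h0.le h1.le ?_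
        rw [Nat.le_div_iff_mul_le two_pos]
        have := Nat.div_mul_le_self j 2
        nlinarith
    _ = (q ^ (j / 2) * |r|) ^ j := by rw [pow_mul, mul_pow]
    _ ≤ (1 / 2) ^ j := by gcongr

theorem norm_theta_term (h0 : 0 < q) (x : ℂ) (j : ℕ) :
    ‖(q : ℂ) ^ (j * (j + 1) / 2) * x ^ j‖ = q ^ (j * (j + 1) / 2) * ‖x‖ ^ j := by
  rw [norm_mul, norm_pow, norm_pow, Complex.norm_real, Real.norm_eq_abs, abs_of_pos h0]

theorem summable_theta (h0 : 0 < q) (h1 : q < 1) (x : ℂ) :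
    Summable fun j : ℕ => (q : ℂ) ^ (j * (j + 1) / 2) * x ^ j := by
  refine Summable.of_norm ?_
  simp only [norm_theta_term h0]
  exact summable_theta_real h0 h1 _

theorem differentiable_theta (h0 : 0 < q) (h1 : q < 1) : Differentiable ℂ (theta q) := by
  intro x
  have hx : x ∈ Metric.ball (0 : ℂ) (‖x‖ + 1) := by simp
  have : DifferentiableOn ℂ (theta q) (Metric.ball (0 : ℂ) (‖x‖ + 1)) := by
    refine Complex.differentiableOn_tsum_of_summable_norm (summable_theta_real h0 h1 (‖x‖ + 1))
      (fun j => by fun_prop) Metric.isOpen_ball fun j y hy => ?_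
    rw [norm_theta_term h0]
    have := (mem_ball_zero_iff.mp hy).le
    gcongr
  exact this.differentiableAt (Metric.isOpen_ball.mem_nhds hx)

theorem theta_zero_right (q : ℂ) : theta q 0 = 1 := by
  rw [theta, tsum_eq_single 0 (fun j hj => by simp [hj])]
  simp

theorem theta_ofReal (q x : ℝ) :
    theta q x = ((∑' j : ℕ, q ^ (j * (j + 1) / 2) * x ^ j : ℝ) : ℂ) := by
  rw [theta, Complex.ofReal_tsum]
  push_cast
  rfl

theorem theta_conj (q : ℝ) (x : ℂ) :
    theta q (starRingEnd ℂ x) = starRingEnd ℂ (theta q x) := by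
  rw [theta, theta, Complex.conj_tsum]
  simp

theorem neg_of_theta_eq_zero (h0 : 0 < q) (h1 : q < 1) {x : ℝ} (hx : theta q x = 0) : x < 0 := by
  by_contra! hx0
  rw [theta_ofReal, Complex.ofReal_eq_zero] at hx
  have := (summable_theta_real h0 h1 x).tsum_pos (fun j => by positivity) 0 (by simp)
  exact this.ne' hx

end theta

theorem norm_theta_le {t : ℝ} (ht : 0 < t) (k : ℕ) {x : ℂ}
    (hx : ‖x‖ = Real.exp (Real.pi * t * (2 * k + 1))) :
    ‖theta (Real.exp (-2 * Real.pi * t) : ℝ) x‖ ≤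
      (∑' m : ℤ, Real.exp (-Real.pi * (m : ℝ) ^ 2 * t)) * Real.exp (Real.pi * t * k ^ 2) := by
  have hsum := summable_exp_neg_pi_sq ht
  have hinj : Function.Injective fun j : ℕ => (j : ℤ) - k := fun a b h => by
    simpa using h
  have hle : ∀ j : ℕ, ‖((Real.exp (-2 * Real.pi * t) : ℝ) : ℂ) ^ (j * (j + 1) / 2) * x ^ j‖ =
      Real.exp (Real.pi * t * k ^ 2) *
        Real.exp (-Real.pi * (((j : ℤ) - k : ℤ) : ℝ) ^ 2 * t) := fun j => by
    rw [norm_theta_term (Real.exp_pos _), hx, exp_pow_triangular_mul]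
  refine (tsum_of_norm_bounded ((hsum.comp_injective hinj).mul_left _).hasSum
    (fun j => (hle j).le)).trans ?_
  rw [tsum_mul_left, mul_comm]
  gcongr
  exact (hsum.comp_injective hinj).tsum_le_tsum_of_inj _ hinj (fun _ _ => (Real.exp_pos _).le)
    (fun _ => le_rfl) hsum

/-- At `x = -exp (π t (2 k + 1))` the partial theta function has the sign `(-1) ^ k` once `k` is
large. -/
theorem eventually_theta_sign {t : ℝ} (ht : 0 < t) :
    ∀ᶠ k : ℕ in Filter.atTop, 0 < (-1) ^ k *
      ∑' j : ℕ, Real.exp (-2 * Real.pi * t) ^ (j * (j + 1) / 2) *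
        (-Real.exp (Real.pi * t * (2 * k + 1))) ^ j := by
  obtain ⟨v, hv, hsum⟩ := exists_hasSum_neg_one_zpow_mul_exp ht
  set b : ℤ → ℝ := fun m => (-1 : ℝ) ^ m * Real.exp (-Real.pi * (m : ℝ) ^ 2 * t) with hb
  have heven : ∀ m, b (-m) = b m := fun m => by
    rcases Int.even_or_odd m with h | h <;> simp [hb, h.neg_one_zpow]
  have htail : Filter.Tendsto (fun k : ℕ => ∑' n : ℕ, b ((n + k : ℕ) + 1)) Filter.atTop
      (nhds 0) := tendsto_sum_nat_add fun n : ℕ => b (n + 1)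
  have hsplit : ∀ k : ℕ, ∑' n : ℕ, b (n - k) + ∑' n : ℕ, b ((n + k : ℕ) + 1) = v := by
    intro k
    have h1 : Summable fun m : ℤ => b (m - k) :=
      hsum.summable.comp_injective (sub_left_injective (b := (k : ℤ)))
    have h2 : ∑' m : ℤ, b (m - k) = v := by
      rw [← hsum.tsum_eq]
      exact (Equiv.subRight (k : ℤ)).tsum_eq b
    have h3 : Summable fun n : ℕ => b (n - k) := h1.comp_injective Nat.cast_injective
    have h4 : Summable fun n : ℕ => b (-((n : ℤ) + 1) - k) :=
      h1.comp_injective (i := fun n : ℕ => -((n : ℤ) + 1)) fun a b h => by simpa using h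
    rw [← h2, tsum_of_nat_of_neg_add_one (f := fun m : ℤ => b (m - k)) h3 h4]
    congr 2
    ext n
    rw [← heven]
    congr 1
    push_cast
    ring
  filter_upwards [htail.eventually_lt_const hv] with k hk
  have hpos : 0 < ∑' n : ℕ, b (n - k) := by linarith [hsplit k]
  have hterm : ∀ j : ℕ, (-1 : ℝ) ^ k * (Real.exp (-2 * Real.pi * t) ^ (j * (j + 1) / 2) *
      (-Real.exp (Real.pi * t * (2 * k + 1))) ^ j) =
      Real.exp (Real.pi * t * k ^ 2) * b (j - k) := fun j => by
    rw [neg_pow (Real.exp _), mul_left_comm (_ ^ _) ((-1) ^ j), exp_pow_triangular_mul, hb]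
    simp only
    rw [zpow_sub₀ (by norm_num), zpow_natCast, zpow_natCast, div_eq_mul_inv, ← inv_pow, inv_neg,
      inv_one]
    ring
  rw [← tsum_mul_left]
  simp only [hterm]
  rw [tsum_mul_left]
  positivity

theorem exists_theta_eq_zero {t : ℝ} (ht : 0 < t) :
    ∃ (k : ℕ) (x : ℕ → ℝ), ∀ i, theta (Real.exp (-2 * Real.pi * t) : ℝ) (x i : ℝ) = 0 ∧
      -Real.exp (Real.pi * t * (2 * (k + i + 1 : ℕ) + 1)) < x i ∧
      x i < -Real.exp (Real.pi * t * (2 * (k + i : ℕ) + 1)) := by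
  obtain ⟨k, hk⟩ := Filter.eventually_atTop.mp (eventually_theta_sign ht)
  have hpi : 0 < Real.pi * t := mul_pos Real.pi_pos ht
  set q := Real.exp (-2 * Real.pi * t) with hq
  have hq1 : q < 1 := by rw [hq, Real.exp_lt_one_iff]; linarith
  have hqpos : 0 < q := Real.exp_pos _
  set F : ℝ → ℝ := fun x => ∑' j : ℕ, q ^ (j * (j + 1) / 2) * x ^ j with hF
  have hFth : ∀ x : ℝ, theta q x = (F x : ℂ) := fun x => theta_ofReal q x
  have hFc : Continuous F := by
    have h1 : Continuous fun x : ℝ => (theta q x).re := Complex.continuous_re.comp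
      ((differentiable_theta hqpos hq1).continuous.comp Complex.continuous_ofReal)
    refine h1.congr fun x => ?_
    rw [hFth, Complex.ofReal_re]
  refine ⟨k, ?_⟩
  have hex : ∀ i, ∃ x : ℝ, theta q x = 0 ∧
      -Real.exp (Real.pi * t * (2 * (k + i + 1 : ℕ) + 1)) < x ∧
      x < -Real.exp (Real.pi * t * (2 * (k + i : ℕ) + 1)) := by
    intro i
    have hA := hk (k + i) (by omega)
    have hB := hk (k + i + 1) (by omega)
    set a := -Real.exp (Real.pi * t * (2 * (k + i : ℕ) + 1)) with ha
    set b := -Real.exp (Real.pi * t * (2 * (k + i + 1 : ℕ) + 1)) with hb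
    have hba : b < a := by
      rw [ha, hb, neg_lt_neg_iff, Real.exp_lt_exp]
      push_cast
      nlinarith
    have h1 : 0 < (-1) ^ (k + i) * F a := hA
    have h2 : 0 < (-1) ^ (k + i + 1) * F b := hB
    have h3 : (0 : ℝ) ∈ Set.Ioo ((-1) ^ (k + i) * F b) ((-1) ^ (k + i) * F a) :=
      ⟨by rw [pow_succ] at h2; linarith, h1⟩
    obtain ⟨x, hx, hx0⟩ := intermediate_value_Ioo hba.le
      (f := fun x => (-1) ^ (k + i) * F x) (by fun_prop) h3
    refine ⟨x, ?_, hx.1, hx.2⟩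
    rw [hFth, Complex.ofReal_eq_zero]
    exact (mul_eq_zero.mp hx0).resolve_left (by simp)
  choose x hx using hex
  exact ⟨x, hx⟩

section zeros

/-- The zeros of `f` in the upper half-plane, repeated according to multiplicity. -/
abbrev UpperZeros (f : ℂ → ℂ) : Type :=
  Σ u : {u : ℂ // f u = 0 ∧ 0 < u.im}, Fin (analyticOrderNatAt f u)

/-- The real zeros of `f`, repeated according to multiplicity. -/
abbrev RealZeros (f : ℂ → ℂ) : Type := Σ r : {r : ℝ // f r = 0}, Fin (analyticOrderNatAt f (r : ℝ))

/-- The non-real zeros of an `f` that commutes with conjugation. -/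
noncomputable def nonrealZero (f : ℂ → ℂ) : UpperZeros f ⊕ UpperZeros f → ℂ :=
  Sum.elim (fun w => (w.1 : ℂ)) (fun w => starRingEnd ℂ (w.1 : ℂ))

/-- All zeros of an `f` that commutes with conjugation. -/
noncomputable def zeroFamily (f : ℂ → ℂ) : (UpperZeros f ⊕ UpperZeros f) ⊕ RealZeros f → ℂ :=
  Sum.elim (nonrealZero f) (fun w => ((w.1 : ℝ) : ℂ))

theorem encard_sum_fibre {α β γ : Type*} (z : α ⊕ β → γ) (u : γ) :
    {w | z w = u}.encard = {a | z (Sum.inl a) = u}.encard + {b | z (Sum.inr b) = u}.encard := by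
  have h : {w | z w = u} =
      Sum.inl '' {a | z (Sum.inl a) = u} ∪ Sum.inr '' {b | z (Sum.inr b) = u} := by
    ext w
    rcases w with w | w <;> simp
  rw [h, Set.encard_union_eq (by
    rw [Set.disjoint_left]; rintro _ ⟨a, _, rfl⟩ ⟨b, _, hb⟩; cases hb),
    Sum.inl_injective.encard_image, Sum.inr_injective.encard_image]

theorem encard_sigma_fin_fibre {α γ : Type*} {n : α → ℕ} {v : α → γ} (hv : Function.Injective v)
    (a : α) : {w : Σ a, Fin (n a) | v w.1 = v a}.encard = n a := by
  have h : {w : Σ a, Fin (n a) | v w.1 = v a} = Sigma.mk a '' Set.univ := by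
    ext ⟨b, i⟩
    simp only [Set.mem_ofPred_eq, Set.image_univ, Set.mem_range]
    constructor
    · intro h
      obtain rfl := hv h
      exact ⟨i, rfl⟩
    · rintro ⟨j, hj⟩
      rw [← (Sigma.mk.inj_iff.mp hj).1]
  rw [h, sigma_mk_injective.encard_image, Set.encard_univ]
  simp

theorem iteratedDeriv_comp_conj {f : ℂ → ℂ}
    (hf : ∀ x, f (starRingEnd ℂ x) = starRingEnd ℂ (f x)) (n : ℕ) (x : ℂ) :
    iteratedDeriv n f (starRingEnd ℂ x) = starRingEnd ℂ (iteratedDeriv n f x) := by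
  induction n generalizing x with
  | zero => simpa using hf x
  | succ n ih =>
    have h : starRingEnd ℂ ∘ iteratedDeriv n f ∘ starRingEnd ℂ = iteratedDeriv n f := by
      ext y
      simp [ih]
    have h2 := congrFun (deriv_conj_conj (f := iteratedDeriv n f)) (starRingEnd ℂ x)
    rw [h] at h2
    simpa [iteratedDeriv_succ] using h2

variable {f : ℂ → ℂ}

theorem analyticOrderAt_ne_top_of_map_zero (hd : Differentiable ℂ f) (h0 : f 0 = 1) (u : ℂ) :
    analyticOrderAt f u ≠ ⊤ := by
  intro h
  have := (AnalyticOnNhd.analyticOrderAt_eq_top_iff_eq_zero u fun x => hd.analyticAt x).mp h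
  simp [this] at h0

theorem analyticOrderAt_conj (hd : Differentiable ℂ f) (h0 : f 0 = 1)
    (hf : ∀ x, f (starRingEnd ℂ x) = starRingEnd ℂ (f x)) (u : ℂ) :
    analyticOrderAt f (starRingEnd ℂ u) = analyticOrderAt f u := by
  rw [← Nat.cast_analyticOrderNatAt (analyticOrderAt_ne_top_of_map_zero hd h0 u),
    analyticOrderAt_eq_nat_iff_iteratedDeriv_eq_zero (hd.analyticAt _)]
  have := (analyticOrderAt_eq_nat_iff_iteratedDeriv_eq_zero (hd.analyticAt u)).mp
    (Nat.cast_analyticOrderNatAt (analyticOrderAt_ne_top_of_map_zero hd h0 u)).symm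
  simpa [iteratedDeriv_comp_conj hf] using this

theorem encard_upperZeros (hd : Differentiable ℂ f) (h0 : f 0 = 1) {u : ℂ} (hu : 0 < u.im) :
    {w : UpperZeros f | (w.1 : ℂ) = u}.encard = analyticOrderAt f u := by
  by_cases hz : f u = 0
  · rw [← Nat.cast_analyticOrderNatAt (analyticOrderAt_ne_top_of_map_zero hd h0 u)]
    exact encard_sigma_fin_fibre (v := fun a : {u : ℂ // f u = 0 ∧ 0 < u.im} => (a : ℂ))
      Subtype.val_injective ⟨u, hz, hu⟩
  · rw [(hd.analyticAt u).analyticOrderAt_eq_zero.mpr hz, Set.encard_eq_zero,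
      Set.eq_empty_iff_forall_notMem]
    rintro w rfl
    exact hz w.1.2.1

theorem encard_upperZeros_of_nonpos {u : ℂ} (hu : u.im ≤ 0) :
    {w : UpperZeros f | (w.1 : ℂ) = u}.encard = 0 := by
  rw [Set.encard_eq_zero, Set.eq_empty_iff_forall_notMem]
  rintro w rfl
  exact hu.not_gt w.1.2.2

theorem encard_realZeros (hd : Differentiable ℂ f) (h0 : f 0 = 1) (r : ℝ) :
    {w : RealZeros f | ((w.1 : ℝ) : ℂ) = r}.encard = analyticOrderAt f r := by
  by_cases hz : f r = 0
  · rw [← Nat.cast_analyticOrderNatAt (analyticOrderAt_ne_top_of_map_zero hd h0 r)]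
    exact encard_sigma_fin_fibre (v := fun a : {r : ℝ // f r = 0} => ((a : ℝ) : ℂ))
      (Complex.ofReal_injective.comp Subtype.val_injective) ⟨r, hz⟩
  · rw [(hd.analyticAt _).analyticOrderAt_eq_zero.mpr hz, Set.encard_eq_zero,
      Set.eq_empty_iff_forall_notMem]
    intro w hw
    exact hz (by rw [← hw]; exact w.1.2)

theorem encard_zeroFamily (hd : Differentiable ℂ f) (h0 : f 0 = 1)
    (hf : ∀ x, f (starRingEnd ℂ x) = starRingEnd ℂ (f x)) (u : ℂ) :
    {w | zeroFamily f w = u}.encard = analyticOrderAt f u := by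
  have hconj : ∀ w : UpperZeros f, starRingEnd ℂ (w.1 : ℂ) = u ↔ (w.1 : ℂ) = starRingEnd ℂ u :=
    fun w => ⟨fun h => by rw [← h, Complex.conj_conj], fun h => by rw [h, Complex.conj_conj]⟩
  rw [encard_sum_fibre]
  simp only [zeroFamily, Sum.elim_inl, Sum.elim_inr]
  rw [encard_sum_fibre]
  simp only [nonrealZero, Sum.elim_inl, Sum.elim_inr, hconj]
  have hreal : u.im ≠ 0 → {w : RealZeros f | ((w.1 : ℝ) : ℂ) = u}.encard = 0 := by
    intro hu
    rw [Set.encard_eq_zero, Set.eq_empty_iff_forall_notMem]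
    rintro w rfl
    exact hu (Complex.ofReal_im _)
  rcases lt_trichotomy u.im 0 with hu | hu | hu
  · rw [hreal hu.ne, encard_upperZeros_of_nonpos hu.le,
      encard_upperZeros hd h0 (by simpa using hu), analyticOrderAt_conj hd h0 hf]
    simp
  · rw [encard_upperZeros_of_nonpos hu.le, encard_upperZeros_of_nonpos (by simp [hu])]
    obtain ⟨r, rfl⟩ : ∃ r : ℝ, (r : ℂ) = u := ⟨u.re, Complex.ext rfl (by simp [hu])⟩
    rw [encard_realZeros hd h0]
    simp
  · rw [hreal hu.ne', encard_upperZeros hd h0 hu, encard_upperZeros_of_nonpos (by simpa using hu.le)]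
    simp

end zeros

theorem exists_thetaGrowth_theta {q : ℝ} (h0 : 0 < q) (h1 : q < 1) :
    ∃ (d : ℕ → (UpperZeros (theta q) ⊕ UpperZeros (theta q)) ⊕ RealZeros (theta q))
      (c s B C : ℝ), ThetaGrowth (theta q) (zeroFamily (theta q)) d c s B C ∧
        ∀ i, ∃ r, d i = Sum.inr r := by
  obtain ⟨t, ht, hqt⟩ : ∃ t : ℝ, 0 < t ∧ q = Real.exp (-2 * Real.pi * t) := by
    refine ⟨-Real.log q / (2 * Real.pi),
      div_pos (neg_pos.mpr (Real.log_neg h0 h1)) (by positivity), ?_⟩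
    rw [show -2 * Real.pi * (-Real.log q / (2 * Real.pi)) = Real.log q by field_simp,
      Real.exp_log h0]
  have hd := differentiable_theta h0 h1
  have hpi : 0 < Real.pi * t := mul_pos Real.pi_pos ht
  obtain ⟨k, x, hx⟩ := exists_theta_eq_zero ht
  rw [← hqt] at hx
  have hpos : ∀ i, 0 < analyticOrderNatAt (theta q) (x i) := fun i => by
    have h2 : analyticOrderAt (theta q) (x i) ≠ 0 :=
      (hd.analyticAt _).analyticOrderAt_ne_zero.mpr (hx i).1
    rw [← Nat.cast_analyticOrderNatAt
      (analyticOrderAt_ne_top_of_map_zero hd (theta_zero_right _) _)] at h2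
    exact Nat.pos_of_ne_zero (by exact_mod_cast h2)
  have hanti : StrictAnti x := strictAnti_nat_of_succ_lt fun i => (hx (i + 1)).2.2.trans (hx i).2.1
  have hneg : ∀ i, x i < 0 := fun i => neg_of_theta_eq_zero h0 h1 (hx i).1
  set A : ℝ := ∑' m : ℤ, Real.exp (-Real.pi * (m : ℝ) ^ 2 * t) with hA
  have hA1 : 1 ≤ A := by
    have := (summable_exp_neg_pi_sq ht).le_tsum 0 fun _ _ => (Real.exp_pos _).le
    rwa [show Real.exp (-Real.pi * ((0 : ℤ) : ℝ) ^ 2 * t) = 1 by simp] at this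
  have hcs : ∀ n : ℕ, Real.exp (Real.pi * t * (2 * (k + 1 : ℕ) + 1)) *
      Real.exp (Real.pi * t) ^ (2 * n) = Real.exp (Real.pi * t * (2 * (k + n + 1 : ℕ) + 1)) := by
    intro n
    rw [← Real.exp_nat_mul, ← Real.exp_add]
    congr 1
    push_cast
    ring
  refine ⟨fun i => Sum.inr ⟨⟨x i, (hx i).1⟩, ⟨0, hpos i⟩⟩,
    Real.exp (Real.pi * t * (2 * (k + 1 : ℕ) + 1)), Real.exp (Real.pi * t),
    Real.exp (Real.pi * t * (2 * (k + 1))), A * Real.exp (Real.pi * t * (k + 1) ^ 2),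
    ⟨hd, theta_zero_right _, encard_zeroFamily hd (theta_zero_right _) (theta_conj q), ?_,
      Real.exp_pos _, Real.one_lt_exp_iff.mpr hpi, Real.one_le_exp (by positivity), ?_, ?_, ?_, ?_⟩,
    fun i => ⟨_, rfl⟩⟩
  · intro a b hab
    have := congrArg (zeroFamily (theta q)) hab
    exact hanti.injective (Complex.ofReal_injective this)
  · exact one_le_mul_of_one_le_of_one_le hA1 (Real.one_le_exp (by positivity))
  · intro i
    rw [hcs]
    simp only [zeroFamily, Sum.elim_inr, Complex.norm_real, Real.norm_eq_abs]
    rw [abs_of_neg (hneg i)]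
    have h2 := (hx i).2.2
    calc Real.exp (Real.pi * t * (2 * (k + i + 1 : ℕ) + 1)) =
        Real.exp (Real.pi * t) ^ 2 * Real.exp (Real.pi * t * (2 * (k + i : ℕ) + 1)) := by
          rw [← Real.exp_nat_mul, ← Real.exp_add]
          congr 1
          push_cast
          ring
      _ ≤ _ := by gcongr; linarith
  · intro i
    rw [hcs]
    simp only [zeroFamily, Sum.elim_inr, Complex.norm_real, Real.norm_eq_abs]
    rw [abs_of_neg (hneg i)]
    linarith [(hx i).2.1]
  · intro n y hy
    rw [hcs] at hy
    have := norm_theta_le ht (k + n + 1) hy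
    rw [← hqt] at this
    refine this.trans (le_of_eq ?_)
    rw [← hA, ← Real.exp_nat_mul, ← Real.exp_nat_mul, mul_assoc A, mul_assoc A, ← Real.exp_add,
      ← Real.exp_add]
    congr 2
    push_cast
    ring

theorem finite_upperZeros_theta {q : ℝ} (h0 : 0 < q) (h1 : q < 1) :
    Finite (UpperZeros (theta q)) := by
  obtain ⟨d, c, s, B, C, hG, hdr⟩ := exists_thetaGrowth_theta h0 h1
  have hmem : ∀ w : UpperZeros (theta q), Sum.inl (Sum.inl w) ∈ (Set.range d)ᶜ := by
    rintro w ⟨i, hi⟩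
    obtain ⟨r, hr⟩ := hdr i
    rw [hr] at hi
    cases hi
  refine Set.finite_univ_iff.mp (Set.Finite.of_finite_image (hG.finite_compl_range.subset
    (Set.image_subset_iff.mpr fun w _ => hmem w))
    (Sum.inl_injective.comp Sum.inl_injective).injOn)

theorem nonempty_nat_equiv_realZeros_theta {q : ℝ} (h0 : 0 < q) (h1 : q < 1) :
    Nonempty (ℕ ≃ RealZeros (theta q)) := by
  obtain ⟨d, c, s, B, C, hG, hdr⟩ := exists_thetaGrowth_theta h0 h1
  choose r hr using hdr
  have hr_inj : Function.Injective r := fun a b hab => hG.inj (by rw [hr, hr, hab])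
  have : Infinite (RealZeros (theta q)) := Infinite.of_injective r hr_inj
  have hc := hG.summable_inv_norm.countable_support
  rw [show (Function.support fun w => ‖zeroFamily (theta q) w‖⁻¹) = Set.univ from
    Set.eq_univ_of_forall fun w => by simpa using hG.ne_zero w] at hc
  have := Set.countable_univ_iff.mp hc
  have : Countable (RealZeros (theta q)) := (Sum.inr_injective : Function.Injective
    (Sum.inr : _ → (UpperZeros (theta q) ⊕ UpperZeros (theta q)) ⊕ RealZeros (theta q))).countable
  exact nonempty_equiv_of_countable

theorem ncard_add_ncard_of_equiv {α α' β β' γ : Type*} (e : α' ≃ α) (e' : β' ≃ β) {z : α ⊕ β → γ}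
    {u : γ} {m : ℕ} (h : {w | z w = u}.encard = m) :
    {i | z (Sum.inl (e i)) = u}.ncard + {k | z (Sum.inr (e' k)) = u}.ncard = m := by
  rw [encard_sum_fibre, ← Set.encard_preimage_of_bijective e.bijective,
    ← Set.encard_preimage_of_bijective e'.bijective] at h
  have htop := WithTop.add_ne_top.mp (h.trans_ne (ENat.natCast_ne_top m))
  have h2 := congrArg ENat.toNat h
  rwa [ENat.toNat_add htop.1 htop.2, ENat.toNat_natCast] at h2

theorem summable_inv_norm_realZeros_theta {q : ℝ} (h0 : 0 < q) (h1 : q < 1) :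
    Summable fun w : RealZeros (theta q) => ‖((w.1 : ℝ) : ℂ)‖⁻¹ := by
  obtain ⟨d, c, s, B, C, hG, -⟩ := exists_thetaGrowth_theta h0 h1
  have h := hG.summable_inv_norm.comp_injective (Sum.inr_injective : Function.Injective
    (Sum.inr : RealZeros (theta q) → (UpperZeros (theta q) ⊕ UpperZeros (theta q)) ⊕ _))
  exact h

theorem stmt4 (q : ℝ) (h0 : 0 < q) (h1 : q < 1) :
    Set.Finite {x : ℂ | theta (q : ℂ) x = 0 ∧ x.im ≠ 0} ∧
    (∀ t : ℝ, theta (q : ℂ) (t : ℂ) = 0 → t < 0) ∧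
    ∃ (j : ℕ) (η : Fin (2 * j) → ℂ) (ξ : ℕ → ℝ) (σ : Fin (2 * j) ≃ Fin (2 * j)),
      (∀ i, (η i).im ≠ 0) ∧
      -- the non-real zeros come in complex-conjugate pairs
      (∀ i, η (σ i) = starRingEnd ℂ (η i)) ∧
      -- the `-η i` are exactly the non-real zeros
      (∀ x : ℂ, (theta (q : ℂ) x = 0 ∧ x.im ≠ 0) ↔ ∃ i, x = -η i) ∧
      (∀ k, 0 < ξ k) ∧
      -- the `-ξ k` are exactly the real zeros
      (∀ t : ℝ, theta (q : ℂ) (t : ℂ) = 0 ↔ ∃ k, t = -ξ k) ∧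
      -- zeros are listed with the correct multiplicities
      (∀ z : ℂ, theta (q : ℂ) z = 0 →
        ∃ m : ℕ, ZeroMult (theta (q : ℂ)) z m ∧
          Set.ncard {i | η i = -z} + Set.ncard {k : ℕ | (ξ k : ℂ) = -z} = m) ∧
      Summable (fun k : ℕ => 1 / ξ k) ∧
      ∃ L : ℂ → ℂ,
        (∀ x : ℂ, HasProd (fun k : ℕ => 1 + x / (ξ k : ℂ)) (L x)) ∧
        ∀ x : ℂ, theta (q : ℂ) x = (∏ i, (1 + x / η i)) * L x := by
  obtain ⟨d, c, s, B, C, hG, -⟩ := exists_thetaGrowth_theta h0 h1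
  have hd := hG.diff
  have hneg : ∀ t : ℝ, theta q t = 0 → t < 0 := fun t => neg_of_theta_eq_zero h0 h1
  have : Finite (UpperZeros (theta q)) := finite_upperZeros_theta h0 h1
  have : Fintype (UpperZeros (theta q)) := Fintype.ofFinite _
  obtain ⟨e⟩ := nonempty_nat_equiv_realZeros_theta h0 h1
  obtain ⟨j, ⟨eN⟩⟩ : ∃ j, Nonempty (Fin (2 * j) ≃ UpperZeros (theta q) ⊕ UpperZeros (theta q)) :=
    ⟨Nat.card (UpperZeros (theta q)),
      ⟨(Finite.equivFinOfCardEq (by rw [Nat.card_sum, two_mul])).symm⟩⟩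
  have him : ∀ w, (nonrealZero (theta q) w).im ≠ 0 := by
    rintro (w | w)
    · exact w.1.2.2.ne'
    · simpa [nonrealZero] using w.1.2.2.ne'
  have hswap : ∀ w, nonrealZero (theta q) w.swap = starRingEnd ℂ (nonrealZero (theta q) w) := by
    rintro (w | w) <;> simp [nonrealZero]
  have hfib : ∀ u, theta q u = 0 → ∃ w, zeroFamily (theta q) w = u := by
    intro u hu
    have h2 := (hd.analyticAt u).analyticOrderAt_ne_zero.mpr hu
    rw [← hG.encard_eq, Set.encard_ne_zero] at h2
    exact h2
  have hnonreal : ∀ x : ℂ, (theta q x = 0 ∧ x.im ≠ 0) ↔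
      ∃ i, x = - -nonrealZero (theta q) (eN i) := by
    intro x
    simp only [neg_neg]
    constructor
    · rintro ⟨hx, hxi⟩
      obtain ⟨w | w, rfl⟩ := hfib x hx
      · exact ⟨eN.symm w, by simp [zeroFamily]⟩
      · exact absurd (Complex.ofReal_im _) hxi
    · rintro ⟨i, rfl⟩
      exact ⟨hG.apply_eq_zero (Sum.inl (eN i)), him _⟩
  have hsum : Summable fun w : RealZeros (theta q) => ‖((w.1 : ℝ) : ℂ)‖⁻¹ :=
    summable_inv_norm_realZeros_theta h0 h1
  have hmulR : ∀ x : ℂ, Multipliable fun w : RealZeros (theta q) => 1 - x / ((w.1 : ℝ) : ℂ) := by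
    intro x
    simp_rw [sub_eq_add_neg]
    exact multipliable_one_add_of_summable (by simpa [div_eq_mul_inv] using hsum.mul_left ‖x‖)
  have hcongr : ∀ x : ℂ, (fun k => 1 + x / ((-((e k).1 : ℝ) : ℝ) : ℂ)) =
      (fun w : RealZeros (theta q) => 1 - x / ((w.1 : ℝ) : ℂ)) ∘ e := fun x => by
    ext k
    simp [div_neg, sub_eq_add_neg]
  refine ⟨?_, hneg, j, fun i => -nonrealZero (theta q) (eN i), fun k => -((e k).1 : ℝ),
    eN.trans ((Equiv.sumComm _ _).trans eN.symm), fun i => by simpa using him _,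
    fun i => by simp [hswap], hnonreal, fun k => neg_pos.mpr (hneg _ (e k).1.2), ?_, ?_, ?_,
    fun x => ∏' k, (1 + x / ((-((e k).1 : ℝ) : ℝ) : ℂ)), fun x => ?_, fun x => ?_⟩
  · refine (Set.finite_range fun i => - -nonrealZero (theta q) (eN i)).subset ?_
    intro x hx
    obtain ⟨i, rfl⟩ := (hnonreal x).mp hx
    exact ⟨i, rfl⟩
  · intro t
    simp only [neg_neg]
    constructor
    · intro ht
      obtain ⟨w | w, hw⟩ := hfib t ht
      · exact absurd (by rw [show nonrealZero (theta q) w = t from hw]; simp) (him w)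
      · exact ⟨e.symm w, by simpa using (Complex.ofReal_injective hw).symm⟩
    · rintro ⟨k, rfl⟩
      exact (e k).1.2
  · intro z hz
    have hm := (Nat.cast_analyticOrderNatAt
      (analyticOrderAt_ne_top_of_map_zero hd hG.map_zero z)).symm
    refine ⟨analyticOrderNatAt (theta q) z,
      (analyticOrderAt_eq_nat_iff_iteratedDeriv_eq_zero (hd.analyticAt z)).mp hm, ?_⟩
    simpa [zeroFamily, neg_inj] using ncard_add_ncard_of_equiv eN e ((hG.encard_eq z).trans hm)
  · simpa [abs_of_neg (hneg _ (e _).1.2), Function.comp_def] using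
      hsum.comp_injective e.injective
  · beta_reduce
    rw [hcongr]
    exact ((e.multipliable_iff).mpr (hmulR x)).hasProd
  · have h2 := HasProd.sum (f := fun w => 1 - x / zeroFamily (theta q) w)
      (hasProd_fintype fun w => 1 - x / zeroFamily (theta q) (Sum.inl w)) (hmulR x).hasProd
    rw [(hG.hasProd x).unique h2, ← eN.prod_comp, ← e.tprod_eq]
    beta_reduce
    rw [hcongr]
    simp [zeroFamily, div_neg, sub_eq_add_neg, Function.comp_def]
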